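/- arXiv:1109.1060 — 2 statements merged into one kernel-verified Lean document; each statement's English description precedes it below -/
import Mathlib

section
/- Let L be a finite-dimensional left Leibniz algebra over a field k of characteristic 0, and let R be the soluble radical of L (the largest soluble ideal of L, equivalently the sum of all soluble ideals). Then there exists a subalgebra S of L such that S + R = L and S ∩ R = 0 (and S, being a Leibniz algebra with trivial Leibniz kernel, is a semisimple Lie algebra). -/
/-- The subspace spanned by all products `a * b` with `a ∈ I`, `b ∈ J`. -/
def LeibnizMulSpan {k L : Type*} [Field k] [AddCommGroup L] [Module k L]
    (mul : L →ₗ[k] L →ₗ[k] L) (I J : Submodule k L) : Submodule k L :=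
  Submodule.span k {z | ∃ a ∈ I, ∃ b ∈ J, z = mul a b}

/-- `I` is a (two-sided) ideal of the Leibniz algebra `L`. -/
def LeibnizIsIdeal {k L : Type*} [Field k] [AddCommGroup L] [Module k L]
    (mul : L →ₗ[k] L →ₗ[k] L) (I : Submodule k L) : Prop :=
  ∀ x : L, ∀ a ∈ I, mul x a ∈ I ∧ mul a x ∈ I

/-- The derived series of a subspace `I`: `I ⊇ I² ⊇ (I²)² ⊇ …`. -/
def LeibnizDerivedSeries {k L : Type*} [Field k] [AddCommGroup L] [Module k L]
    (mul : L →ₗ[k] L →ₗ[k] L) (I : Submodule k L) : ℕ → Submodule k L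
  | 0 => I
  | n + 1 => LeibnizMulSpan mul (LeibnizDerivedSeries mul I n) (LeibnizDerivedSeries mul I n)

/-- `I` is soluble: its derived series reaches `0`. -/
def LeibnizIsSoluble {k L : Type*} [Field k] [AddCommGroup L] [Module k L]
    (mul : L →ₗ[k] L →ₗ[k] L) (I : Submodule k L) : Prop :=
  ∃ n, LeibnizDerivedSeries mul I n = ⊥

/-- `S` is a subalgebra: a subspace closed under the product. -/
def LeibnizIsSubalgebra {k L : Type*} [Field k] [AddCommGroup L] [Module k L]
    (mul : L →ₗ[k] L →ₗ[k] L) (S : Submodule k L) : Prop :=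
  ∀ a ∈ S, ∀ b ∈ S, mul a b ∈ S

section

open LieAlgebra LieModule Module

attribute [local instance] LieRing.ofAssociativeRing

/-- A Killing Lie algebra is perfect. -/
theorem LieAlgebra.IsKilling.derivedSeries_one_eq_top (k G : Type*) [Field k] [LieRing G]
    [LieAlgebra k G] [FiniteDimensional k G] [IsKilling k G] : derivedSeries k G 1 = ⊤ := by
  have hbot : (derivedSeries k G 1).killingCompl = ⊥ := by
    refine (LieSubmodule.eq_bot_iff _).mpr fun x hx ↦ ?_
    have hc : x ∈ center k G := by
      intro y
      have hker : ⁅y, x⁆ ∈ LinearMap.ker (killingForm k G) := by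
        refine LinearMap.mem_ker.mpr (LinearMap.ext fun z ↦ ?_)
        rw [LinearMap.zero_apply, traceForm_apply_lie_apply', neg_eq_zero, traceForm_comm]
        exact hx _ (LieSubmodule.lie_mem_lie (LieSubmodule.mem_top y) (LieSubmodule.mem_top z))
      simpa using hker
    simpa using hc
  have hcompl := LieIdeal.isCompl_killingCompl (derivedSeries k G 1)
  rw [hbot] at hcompl
  simpa using hcompl.codisjoint.eq_top

/-- Each nonzero invariant symmetric bilinear form on a Killing Lie algebra is detected by
an invariant tensor `∑ eᵢ ⊗ e'ᵢ`. -/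
theorem LieAlgebra.IsKilling.exists_invariant_tensor {k G : Type*} [Field k] [CharZero k]
    [LieRing G] [LieAlgebra k G] [FiniteDimensional k G] [IsKilling k G]
    (B : LinearMap.BilinForm k G) (hsymm : B.IsSymm) (hinv : B.lieInvariant G) (hB : B ≠ 0) :
    ∃ (n : ℕ) (e e' : Fin n → G),
      (∀ (W : Type _) [AddCommGroup W] [Module k W] (β : G →ₗ[k] G →ₗ[k] W) (x : G),
        ∑ i, (β ⁅x, e i⁆ (e' i) + β (e i) ⁅x, e' i⁆) = 0) ∧
      ∑ i, B (e i) (e' i) ≠ 0 := by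
  let I : LieIdeal k G :=
    { LinearMap.ker B with
      lie_mem := by
        intro x y hy
        have hy' : B y = 0 := hy
        change B ⁅x, y⁆ = 0
        ext z
        rw [hinv, hy']
        simp }
  have hI : ∀ x, x ∈ I ↔ B x = 0 := fun x ↦ Iff.rfl
  let J := I.killingCompl
  have hIJ : IsCompl I J := LieIdeal.isCompl_killingCompl I
  have hsup : I.toSubmodule ⊔ J.toSubmodule = ⊤ := by
    simpa using congrArg LieSubmodule.toSubmodule hIJ.sup_eq_top
  let b := finBasis k J
  have hsymmJ : (B.restrict J.toSubmodule).IsSymm := ⟨fun x y ↦ hsymm.eq x y⟩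
  have hnd : (B.restrict J.toSubmodule).Nondegenerate := by
    refine hsymmJ.isRefl.nondegenerate_iff_separatingLeft.mpr fun x hx ↦ ?_
    have hxI : (x : G) ∈ I := by
      rw [hI]
      ext y
      obtain ⟨u, hu, w, hw, rfl⟩ := Submodule.mem_sup.mp (hsup ▸ Submodule.mem_top : y ∈ _)
      have h1 : B x u = 0 := by
        rw [← hsymm.eq]
        have : B u = 0 := hu
        simp [this]
      have h2 : B x w = 0 := hx ⟨w, hw⟩
      simp [h1, h2]
    have hx0 : (x : G) ∈ (⊥ : LieIdeal k G) := hIJ.inf_eq_bot ▸ ⟨hxI, x.2⟩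
    exact Subtype.ext hx0
  let b' := (B.restrict J.toSubmodule).dualBasis hnd b
  have hbb' : ∀ i j, B (b i) (b' j) = if i = j then 1 else 0 := fun i j ↦
    LinearMap.BilinForm.apply_dualBasis_right hnd hsymmJ b i j
  have hexp' : ∀ y ∈ J, y = ∑ j, B y (b j) • (b' j : G) := by
    intro y hy
    have h1 : y = _ := (congrArg Subtype.val (b'.sum_repr ⟨y, hy⟩)).symm
    conv_lhs => rw [h1]
    simp [b', LinearMap.BilinForm.dualBasis_repr_apply]
  have hexp : ∀ y ∈ J, y = ∑ j, B y (b' j) • (b j : G) := by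
    intro y hy
    have h1 : y = _ := (congrArg Subtype.val (b.sum_repr ⟨y, hy⟩)).symm
    have h2 : ∀ j, B y (b' j) = b.repr ⟨y, hy⟩ j := by
      intro j
      conv_lhs => rw [h1]
      simp [-Basis.sum_repr, hbb']
    conv_lhs => rw [h1]
    simp [-Basis.sum_repr, h2]
  refine ⟨_, fun i ↦ (b i : G), fun i ↦ (b' i : G), ?_, ?_⟩
  · intro W _ _ β x
    have e1 : ∀ i, β ⁅x, (b i : G)⁆ (b' i) = ∑ j, B ⁅x, (b i : G)⁆ (b' j) • β (b j) (b' i) := by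
      intro i
      conv_lhs => rw [hexp ⁅x, (b i : G)⁆ (J.lie_mem (b i).2)]
      simp
    have e2 : ∀ i, β (b i) ⁅x, (b' i : G)⁆ = ∑ j, B ⁅x, (b' i : G)⁆ (b j) • β (b i) (b' j) := by
      intro i
      conv_lhs => rw [hexp' ⁅x, (b' i : G)⁆ (J.lie_mem (b' i).2)]
      simp
    rw [Finset.sum_add_distrib, Finset.sum_congr rfl fun i _ ↦ e1 i,
      Finset.sum_congr rfl fun i _ ↦ e2 i, Finset.sum_comm, ← Finset.sum_add_distrib]
    refine Finset.sum_eq_zero fun i _ ↦ ?_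
    rw [← Finset.sum_add_distrib]
    refine Finset.sum_eq_zero fun j _ ↦ ?_
    rw [hinv, ← hsymm.eq ⁅x, (b' i : G)⁆, ← add_smul, neg_add_cancel, zero_smul]
  · simp only [hbb', if_true, Finset.sum_const, Finset.card_univ, Fintype.card_fin, nsmul_eq_mul,
      mul_one]
    rw [Nat.cast_ne_zero]
    intro h0
    apply hB
    have : J.toSubmodule = ⊥ := Submodule.finrank_eq_zero.mp h0
    rw [this, sup_bot_eq] at hsup
    ext x
    have hx : x ∈ I.toSubmodule := hsup ▸ Submodule.mem_top
    have : B x = 0 := hx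
    simp [this]

/-- **Whitehead's first lemma** for irreducible modules. -/
theorem LieModule.exists_eq_lie_of_cocycle_of_isIrreducible {k G V : Type*} [Field k] [CharZero k]
    [LieRing G] [LieAlgebra k G] [FiniteDimensional k G] [IsKilling k G]
    [AddCommGroup V] [Module k V] [FiniteDimensional k V] [LieRingModule G V] [LieModule k G V]
    [LieModule.IsIrreducible k G V]
    (f : G →ₗ[k] V) (hf : ∀ x y, f ⁅x, y⁆ = ⁅x, f y⁆ - ⁅y, f x⁆) :
    ∃ v : V, ∀ x, f x = ⁅x, v⁆ := by
  have hnt : Nontrivial V := LieModule.nontrivial_of_isIrreducible k G V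
  by_cases hB : traceForm k G V = 0
  · have hnil := isNilpotent_derivedSeries_of_traceForm_eq_zero hB
    rw [IsKilling.derivedSeries_one_eq_top] at hnil
    have := LieModule.nontrivial_max_triv_of_isNilpotent k (⊤ : LieIdeal k G) V
    obtain ⟨⟨m, hm⟩, hm0⟩ := exists_ne (0 : maxTrivSubmodule k (⊤ : LieIdeal k G) V)
    have hmem : m ∈ maxTrivSubmodule k G V := fun x ↦ hm ⟨x, LieSubmodule.mem_top x⟩
    have htop : maxTrivSubmodule k G V = ⊤ := by
      refine (IsSimpleOrder.eq_bot_or_eq_top _).resolve_left fun h ↦ hm0 ?_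
      rw [h] at hmem
      exact Subtype.ext hmem
    have htriv : ∀ (x : G) (v : V), ⁅x, v⁆ = 0 := fun x v ↦
      (htop ▸ LieSubmodule.mem_top v : v ∈ maxTrivSubmodule k G V) x
    refine ⟨0, fun x ↦ ?_⟩
    have hx : x ∈ derivedSeries k G 1 :=
      IsKilling.derivedSeries_one_eq_top k G ▸ LieSubmodule.mem_top x
    have hle : (derivedSeries k G 1).toSubmodule ≤ LinearMap.ker f := by
      rw [derivedSeries_def, derivedSeriesOfIdeal_succ, derivedSeriesOfIdeal_zero,
        LieSubmodule.lieIdeal_oper_eq_linear_span', Submodule.span_le]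
      rintro _ ⟨a, -, b, -, rfl⟩
      simp [hf, htriv]
    simpa using hle hx
  obtain ⟨n, e, e', hinv, htr⟩ := IsKilling.exists_invariant_tensor (traceForm k G V)
    ⟨traceForm_comm k G V⟩ (traceForm_lieInvariant k G V) hB
  let C : V →ₗ⁅k, G⁆ V :=
    { ∑ i, toEnd k G V (e i) ∘ₗ toEnd k G V (e' i) with
      map_lie' := by
        intro x v
        have h := hinv V (LinearMap.mk₂ k (fun a b ↦ ⁅a, ⁅b, v⁆⁆) (by simp) (by simp) (by simp)
          (by simp)) x
        simp only [LinearMap.mk₂_apply] at h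
        rw [← sub_eq_zero, ← neg_eq_zero]
        simp only [AddHom.toFun_eq_coe, LinearMap.coe_toAddHom, LinearMap.sum_apply,
          LinearMap.comp_apply, toEnd_apply_apply, neg_sub, lie_sum]
        rw [← Finset.sum_sub_distrib, ← h]
        refine Finset.sum_congr rfl fun i _ ↦ ?_
        rw [leibniz_lie x (e i), leibniz_lie x (e' i), lie_add]
        abel }
  have hC : ∀ v, C v = ∑ i, ⁅e i, ⁅e' i, v⁆⁆ := fun v ↦ by
    change (∑ i, toEnd k G V (e i) ∘ₗ toEnd k G V (e' i)) v = _
    simp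
  have hker : C.ker = ⊥ := by
    refine (IsSimpleOrder.eq_bot_or_eq_top _).resolve_right fun h ↦ htr ?_
    have h0 : ∑ i, toEnd k G V (e i) ∘ₗ toEnd k G V (e' i) = 0 := by
      ext v
      have hv : C v = 0 := LieModuleHom.mem_ker.mp (h ▸ LieSubmodule.mem_top v)
      simpa [hC] using hv
    simpa [traceForm_apply_apply] using congrArg (LinearMap.trace k V) h0
  have hinj : Function.Injective (C : V →ₗ[k] V) := by
    rw [← LinearMap.ker_eq_bot, ← LieModuleHom.ker_toSubmodule, hker, LieSubmodule.bot_toSubmodule]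
  obtain ⟨u, hu⟩ := LinearMap.surjective_of_injective hinj (∑ i, ⁅e i, f (e' i)⁆)
  refine ⟨u, fun x ↦ hinj ?_⟩
  change C (f x) = C ⁅x, u⁆
  rw [LieModuleHom.map_lie, show C u = _ from hu, hC, lie_sum, ← sub_eq_zero, ← neg_eq_zero,
    neg_sub, ← Finset.sum_sub_distrib,
    ← hinv V (LinearMap.mk₂ k (fun a b ↦ ⁅a, f b⁆) (by simp) (by simp) (by simp) (by simp)) x]
  refine Finset.sum_congr rfl fun i _ ↦ ?_
  simp only [LinearMap.mk₂_apply]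
  rw [leibniz_lie x (e i), hf, lie_sub]
  abel

/-- **Whitehead's first lemma**: every 1-cocycle of a Killing Lie algebra with values in a
finite-dimensional module is a coboundary. -/
theorem LieModule.exists_eq_lie_of_cocycle {k G V : Type*} [Field k] [CharZero k]
    [LieRing G] [LieAlgebra k G] [FiniteDimensional k G] [IsKilling k G]
    [AddCommGroup V] [Module k V] [FiniteDimensional k V] [LieRingModule G V] [LieModule k G V]
    (f : G →ₗ[k] V) (hf : ∀ x y, f ⁅x, y⁆ = ⁅x, f y⁆ - ⁅y, f x⁆) :
    ∃ v : V, ∀ x, f x = ⁅x, v⁆ := by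
  induction hn : finrank k V using Nat.strong_induction_on generalizing V with
  | _ n ih =>
  subst hn
  rcases subsingleton_or_nontrivial V with hV | hV
  · exact ⟨0, fun x ↦ Subsingleton.elim _ _⟩
  by_cases hirr : ∀ W : LieSubmodule k G V, W ≠ ⊥ → W = ⊤
  · have := LieModule.IsIrreducible.mk hirr
    exact exists_eq_lie_of_cocycle_of_isIrreducible f hf
  push Not at hirr
  obtain ⟨W, hbot, htop⟩ := hirr
  have hbot' : W.toSubmodule ≠ ⊥ := by simpa using hbot
  have htop' : W.toSubmodule ≠ ⊤ := by simpa using htop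
  have hpos : 0 < finrank k W.toSubmodule :=
    Nat.pos_of_ne_zero fun h ↦ hbot' (Submodule.finrank_eq_zero.mp h)
  have hsum := W.toSubmodule.finrank_quotient_add_finrank
  obtain ⟨q, hq⟩ := ih (finrank k (V ⧸ W)) (by change finrank k (V ⧸ W.toSubmodule) < _; omega)
    ((LieSubmodule.Quotient.mk' W : V →ₗ[k] V ⧸ W) ∘ₗ f)
    (fun x y ↦ by
      change LieSubmodule.Quotient.mk' W (f ⁅x, y⁆) =
        ⁅x, LieSubmodule.Quotient.mk' W (f y)⁆ - ⁅y, LieSubmodule.Quotient.mk' W (f x)⁆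
      rw [hf, map_sub, LieModuleHom.map_lie, LieModuleHom.map_lie]) rfl
  obtain ⟨v, rfl⟩ := LieSubmodule.Quotient.surjective_mk' W q
  have hmem : ∀ x, f x - ⁅x, v⁆ ∈ W := fun x ↦ by
    rw [← LieSubmodule.Quotient.mk_eq_zero, map_sub, LieModuleHom.map_lie, sub_eq_zero]
    exact hq x
  let g : G →ₗ[k] W := LinearMap.codRestrict W.toSubmodule
    (f - LinearMap.flip (toEnd k G V : G →ₗ[k] End k V) v) hmem
  have hg : ∀ x, (g x : V) = f x - ⁅x, v⁆ := fun x ↦ rfl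
  obtain ⟨w, hw⟩ := ih (finrank k W) (Submodule.finrank_lt htop') g (fun x y ↦ by
    apply Subtype.ext
    simp only [hg, hf, LieSubmodule.coe_sub, LieSubmodule.coe_bracket, lie_sub, lie_lie]
    abel) rfl
  refine ⟨v + w, fun x ↦ ?_⟩
  have := congrArg Subtype.val (hw x)
  rw [hg, LieSubmodule.coe_bracket] at this
  rw [lie_add, ← this]
  abel

/-- If `R` contains every ideal whose products all lie in `R`, then `L / R` is a Killing Lie
algebra. -/
theorem leibniz_exists_isKilling_quotient.{u, v} {k : Type u} {L : Type v} [Field k] [CharZero k]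
    [AddCommGroup L] [Module k L] [FiniteDimensional k L] {mul : L →ₗ[k] L →ₗ[k] L}
    (hleib : ∀ x y z : L, mul x (mul y z) = mul (mul x y) z + mul y (mul x z))
    {R : Submodule k L} (hR : LeibnizIsIdeal mul R)
    (hmax : ∀ I : Submodule k L, LeibnizIsIdeal mul I → (∀ a ∈ I, ∀ b ∈ I, mul a b ∈ R) → I ≤ R) :
    ∃ (G : Type v) (_ : LieRing G) (_ : LieAlgebra k G) (π : L →ₗ[k] G),
      FiniteDimensional k G ∧ IsKilling k G ∧ Function.Surjective π ∧
      LinearMap.ker π = R ∧ ∀ x y, π (mul x y) = ⁅π x, π y⁆ := by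
  have hsq_left : ∀ x y, mul (mul x x) y = 0 := fun x y ↦ by
    simpa using hleib x x y
  have hspan_left : ∀ a ∈ Submodule.span k (Set.range fun x ↦ mul x x), ∀ y, mul a y = 0 := by
    intro a ha y
    have hle : Submodule.span k (Set.range fun x ↦ mul x x) ≤ LinearMap.ker (mul.flip y) :=
      Submodule.span_le.mpr (by rintro _ ⟨x, rfl⟩; simpa using hsq_left x y)
    simpa using hle ha
  have hspan : Submodule.span k (Set.range fun x ↦ mul x x) ≤ R := by
    refine hmax _ (fun x a ha ↦ ⟨?_, ?_⟩) fun a ha b _ ↦ ?_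
    · have hle : Submodule.span k (Set.range fun x ↦ mul x x) ≤
          (Submodule.span k (Set.range fun x ↦ mul x x)).comap (mul x) := by
        refine Submodule.span_le.mpr ?_
        rintro _ ⟨y, rfl⟩
        have h : mul x (mul y y) = mul (mul x y + y) (mul x y + y) - mul (mul x y) (mul x y)
            - mul y y := by
          rw [hleib x y y]
          simp only [map_add, LinearMap.add_apply]
          abel
        change mul x (mul y y) ∈ Submodule.span k (Set.range fun x ↦ mul x x)
        rw [h]
        exact sub_mem (sub_mem (Submodule.subset_span ⟨_, rfl⟩) (Submodule.subset_span ⟨_, rfl⟩))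
          (Submodule.subset_span ⟨_, rfl⟩)
      exact hle ha
    · rw [hspan_left a ha]
      exact zero_mem _
    · rw [hspan_left a ha]
      exact zero_mem _
  have hsq : ∀ x, mul x x ∈ R := fun x ↦ hspan (Submodule.subset_span ⟨x, rfl⟩)
  let br : L ⧸ R →ₗ[k] L ⧸ R →ₗ[k] L ⧸ R :=
    LinearMap.liftQ₂ R R (mul.compr₂ R.mkQ)
      (fun a ha ↦ by ext x; simpa using (hR x a ha).2)
      (fun a ha ↦ by ext x; simpa using (hR x a ha).1)
  have hbr : ∀ x y, br (R.mkQ x) (R.mkQ y) = R.mkQ (mul x y) := fun x y ↦ rfl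
  have hsurj : Function.Surjective R.mkQ := R.mkQ_surjective
  let lr : LieRing (L ⧸ R) :=
    { bracket := fun a b ↦ br a b
      add_lie := fun a b c ↦ by change br (a + b) c = br a c + br b c; simp
      lie_add := fun a b c ↦ by change br a (b + c) = br a b + br a c; simp
      lie_self := fun a ↦ by
        obtain ⟨x, rfl⟩ := hsurj a
        change br _ _ = 0
        rw [hbr]
        simpa using hsq x
      leibniz_lie := fun a b c ↦ by
        obtain ⟨x, rfl⟩ := hsurj a
        obtain ⟨y, rfl⟩ := hsurj b
        obtain ⟨z, rfl⟩ := hsurj c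
        change br _ (br _ _) = br (br _ _) _ + br _ (br _ _)
        simp only [hbr, hleib x y z, map_add] }
  let la : LieAlgebra k (L ⧸ R) :=
    { lie_smul := fun t a b ↦ by change br a (t • b) = t • br a b; simp }
  have hπ : ∀ x y, R.mkQ (mul x y) = ⁅R.mkQ x, R.mkQ y⁆ := fun x y ↦ (hbr x y).symm
  have hrad : HasTrivialRadical k (L ⧸ R) := by
    refine (hasTrivialRadical_iff_no_abelian_ideals k (L ⧸ R)).mpr fun I hI ↦ ?_
    have hle : I.toSubmodule.comap R.mkQ ≤ R := by
      refine hmax _ (fun x a ha ↦ ⟨?_, ?_⟩) fun a ha b hb ↦ ?_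
      · change R.mkQ (mul x a) ∈ I
        rw [hπ]
        exact I.lie_mem ha
      · change R.mkQ (mul a x) ∈ I
        rw [hπ]
        exact lie_mem_left k _ I _ _ ha
      · rw [← R.ker_mkQ, LinearMap.mem_ker, hπ]
        exact congrArg Subtype.val (hI.trivial ⟨_, ha⟩ ⟨_, hb⟩)
    refine (LieSubmodule.eq_bot_iff _).mpr fun a ha ↦ ?_
    obtain ⟨x, rfl⟩ := hsurj a
    rw [← LinearMap.mem_ker, R.ker_mkQ]
    exact hle ha
  exact ⟨L ⧸ R, lr, la, R.mkQ, inferInstance, inferInstance, hsurj, R.ker_mkQ, hπ⟩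

/-- Whitehead's first lemma for representations of a Leibniz algebra that factor through
`L / R`. -/
theorem leibniz_exists_eq_apply_of_cocycle {k L V : Type*} [Field k] [CharZero k]
    [AddCommGroup L] [Module k L] [FiniteDimensional k L] {mul : L →ₗ[k] L →ₗ[k] L}
    (hleib : ∀ x y z : L, mul x (mul y z) = mul (mul x y) z + mul y (mul x z))
    {R : Submodule k L} (hR : LeibnizIsIdeal mul R)
    (hmax : ∀ I : Submodule k L, LeibnizIsIdeal mul I → (∀ a ∈ I, ∀ b ∈ I, mul a b ∈ R) → I ≤ R)
    [AddCommGroup V] [Module k V] [FiniteDimensional k V]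
    (ρ : L →ₗ[k] End k V) (hρ : ∀ x y, ρ (mul x y) = ⁅ρ x, ρ y⁆) (hρR : ∀ r ∈ R, ρ r = 0)
    (f : L →ₗ[k] V) (hf : ∀ x y, f (mul x y) = ρ x (f y) - ρ y (f x)) (hfR : ∀ r ∈ R, f r = 0) :
    ∃ v, ∀ x, f x = ρ x v := by
  obtain ⟨G, _, _, π, _, _, hsurj, hker, hπ⟩ := leibniz_exists_isKilling_quotient hleib hR hmax
  obtain ⟨s, hs⟩ := π.exists_rightInverse_of_surjective (LinearMap.range_eq_top.mpr hsurj)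
  have hmem : ∀ x, s (π x) - x ∈ R := fun x ↦ by
    rw [← hker, LinearMap.mem_ker, map_sub, sub_eq_zero]
    exact LinearMap.congr_fun hs (π x)
  let ρ' : G →ₗ[k] End k V := ρ ∘ₗ s
  let f' : G →ₗ[k] V := f ∘ₗ s
  have hρ' : ∀ x, ρ' (π x) = ρ x := fun x ↦ by
    have h := hρR _ (hmem x)
    rwa [map_sub, sub_eq_zero] at h
  have hf' : ∀ x, f' (π x) = f x := fun x ↦ by
    have h := hfR _ (hmem x)
    rwa [map_sub, sub_eq_zero] at h
  let φ : G →ₗ⁅k⁆ End k V :=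
    { ρ' with
      map_lie' := by
        intro a b
        obtain ⟨x, rfl⟩ := hsurj a
        obtain ⟨y, rfl⟩ := hsurj b
        change ρ' ⁅π x, π y⁆ = ⁅ρ' (π x), ρ' (π y)⁆
        rw [← hπ, hρ', hρ', hρ', hρ] }
  let := LieRingModule.compLieHom V φ
  have := LieModule.compLieHom V φ
  have hact : ∀ x v, ⁅π x, v⁆ = ρ x v := fun x v ↦ by
    rw [← hρ']
    rfl
  obtain ⟨v, hv⟩ := LieModule.exists_eq_lie_of_cocycle f' (fun a b ↦ by
    obtain ⟨x, rfl⟩ := hsurj a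
    obtain ⟨y, rfl⟩ := hsurj b
    rw [← hπ, hf', hf', hf', hact, hact, hf])
  exact ⟨v, fun x ↦ by rw [← hf', hv, hact]⟩

/-- Whitehead's first lemma for a subquotient `N / A` of a representation of a Leibniz algebra
on which `R` acts trivially. -/
theorem leibniz_exists_sub_apply_mem_of_cocycle {k L U : Type*} [Field k] [CharZero k]
    [AddCommGroup L] [Module k L] [FiniteDimensional k L] {mul : L →ₗ[k] L →ₗ[k] L}
    (hleib : ∀ x y z : L, mul x (mul y z) = mul (mul x y) z + mul y (mul x z))
    {R : Submodule k L} (hR : LeibnizIsIdeal mul R)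
    (hmax : ∀ I : Submodule k L, LeibnizIsIdeal mul I → (∀ a ∈ I, ∀ b ∈ I, mul a b ∈ R) → I ≤ R)
    [AddCommGroup U] [Module k U] [FiniteDimensional k U]
    (ρ : L →ₗ[k] End k U) (hρ : ∀ x y, ρ (mul x y) = ⁅ρ x, ρ y⁆) (N A : Submodule k U)
    (hN : ∀ x, ∀ u ∈ N, ρ x u ∈ N) (hA : ∀ x, ∀ u ∈ A, ρ x u ∈ A)
    (hρR : ∀ r ∈ R, ∀ u ∈ N, ρ r u ∈ A)
    (f : L →ₗ[k] U) (hf : ∀ x y, f (mul x y) = ρ x (f y) - ρ y (f x))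
    (hfN : ∀ x, f x ∈ N) (hfR : ∀ r ∈ R, f r ∈ A) :
    ∃ v ∈ N, ∀ x, f x - ρ x v ∈ A := by
  let A' := A.comap N.subtype
  let σ : L →ₗ[k] End k (N ⧸ A') :=
    { toFun := fun x ↦ A'.mapQ A' ((ρ x).restrict (hN x)) fun u hu ↦ hA x u hu
      map_add' := fun x y ↦ by
        refine Submodule.linearMap_qext _ (LinearMap.ext fun u ↦ congrArg A'.mkQ ?_)
        ext
        simp
      map_smul' := fun t x ↦ by
        refine Submodule.linearMap_qext _ (LinearMap.ext fun u ↦ congrArg A'.mkQ ?_)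
        ext
        simp }
  have hσ : ∀ x u, σ x (A'.mkQ u) = A'.mkQ ⟨ρ x u, hN x u u.2⟩ := fun x u ↦ rfl
  have hmk : ∀ u : N, A'.mkQ u = 0 ↔ (u : U) ∈ A := fun u ↦ by
    rw [← LinearMap.mem_ker, Submodule.ker_mkQ]
    rfl
  obtain ⟨v, hv⟩ := leibniz_exists_eq_apply_of_cocycle hleib hR hmax σ
    (fun x y ↦ by
      refine Submodule.linearMap_qext _ (LinearMap.ext fun u ↦ ?_)
      change σ _ (A'.mkQ u) = σ x (σ y (A'.mkQ u)) - σ y (σ x (A'.mkQ u))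
      simp only [hσ, ← map_sub]
      refine congrArg A'.mkQ (Subtype.ext ?_)
      simp [hρ, LieRing.of_associative_ring_bracket])
    (fun r hr ↦ by
      refine Submodule.linearMap_qext _ (LinearMap.ext fun u ↦ ?_)
      change σ r (A'.mkQ u) = 0
      rw [hσ, hmk]
      exact hρR r hr u u.2)
    (A'.mkQ ∘ₗ f.codRestrict N hfN)
    (fun x y ↦ by
      simp only [LinearMap.comp_apply, hσ, ← map_sub]
      refine congrArg A'.mkQ (Subtype.ext ?_)
      simp [hf])
    (fun r hr ↦ (hmk _).mpr (hfR r hr))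
  obtain ⟨u, rfl⟩ := A'.mkQ_surjective v
  refine ⟨u, u.2, fun x ↦ ?_⟩
  have h := hv x
  rw [LinearMap.comp_apply, hσ, ← sub_eq_zero, ← map_sub, hmk] at h
  simpa using h

/-- Modulo `K`, there is a projection `q` of `L` onto `R` whose failure to commute with left
multiplications is given by left multiplications by elements of `R`. -/
theorem leibniz_exists_projection {k L : Type*} [Field k] [CharZero k]
    [AddCommGroup L] [Module k L] [FiniteDimensional k L] {mul : L →ₗ[k] L →ₗ[k] L}
    (hleib : ∀ x y z : L, mul x (mul y z) = mul (mul x y) z + mul y (mul x z))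
    {R K : Submodule k L} (hR : LeibnizIsIdeal mul R)
    (hmax : ∀ I : Submodule k L, LeibnizIsIdeal mul I → (∀ a ∈ I, ∀ b ∈ I, mul a b ∈ R) → I ≤ R)
    (hK : LeibnizIsIdeal mul K) (hRK : ∀ a ∈ R, ∀ b ∈ R, mul a b ∈ K) :
    ∃ q : End k L, (∀ y, q y ∈ R) ∧ (∀ y ∈ R, q y - y ∈ K) ∧
      ∀ x, ∃ a ∈ R, ∀ y, mul x (q y) - q (mul x y) - mul a y ∈ K := by
  let ρ : L →ₗ[k] End k (End k L) := (LieAlgebra.ad k (End k L) : End k L →ₗ[k] _) ∘ₗ mul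
  have hρ_apply : ∀ x φ y, ρ x φ y = mul x (φ y) - φ (mul x y) := fun x φ y ↦ rfl
  have hρ : ∀ x y, ρ (mul x y) = ⁅ρ x, ρ y⁆ := fun x y ↦ by
    have h : mul (mul x y) = ⁅mul x, mul y⁆ := by
      ext z
      simp [LieRing.of_associative_ring_bracket, hleib x y z]
    change LieAlgebra.ad k (End k L) (mul (mul x y)) = _
    rw [h, LieHom.map_lie]
    rfl
  let N : Submodule k (End k L) :=
    { carrier := {φ | (∀ y, φ y ∈ R) ∧ ∀ y ∈ R, φ y ∈ K}
      zero_mem' := ⟨fun _ ↦ zero_mem _, fun _ _ ↦ zero_mem _⟩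
      add_mem' := fun ha hb ↦ ⟨fun y ↦ add_mem (ha.1 y) (hb.1 y),
        fun y hy ↦ add_mem (ha.2 y hy) (hb.2 y hy)⟩
      smul_mem' := fun t _ ha ↦ ⟨fun y ↦ R.smul_mem t (ha.1 y),
        fun y hy ↦ K.smul_mem t (ha.2 y hy)⟩ }
  let A : Submodule k (End k L) :=
    { carrier := {φ | ∃ a ∈ R, ∀ y, φ y - mul a y ∈ K}
      zero_mem' := ⟨0, zero_mem _, fun y ↦ by simp⟩
      add_mem' := by
        rintro φ ψ ⟨a, ha, hφ⟩ ⟨b, hb, hψ⟩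
        refine ⟨a + b, add_mem ha hb, fun y ↦ ?_⟩
        have h := add_mem (hφ y) (hψ y)
        rw [sub_add_sub_comm] at h
        simpa using h
      smul_mem' := by
        rintro t φ ⟨a, ha, hφ⟩
        refine ⟨t • a, R.smul_mem t ha, fun y ↦ ?_⟩
        simpa [smul_sub] using K.smul_mem t (hφ y) }
  obtain ⟨p, hp⟩ := R.subtype.exists_leftInverse_of_injective R.ker_subtype
  let p' : End k L := R.subtype ∘ₗ p
  have hpR : ∀ y, p' y ∈ R := fun y ↦ (p y).2
  have hp' : ∀ y ∈ R, p' y = y := fun y hy ↦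
    congrArg Subtype.val (LinearMap.congr_fun hp ⟨y, hy⟩)
  obtain ⟨v, hvN, hv⟩ := leibniz_exists_sub_apply_mem_of_cocycle hleib hR hmax ρ hρ N A
    (fun x φ hφ ↦ ⟨fun y ↦ sub_mem (hR x _ (hφ.1 y)).1 (hφ.1 _),
      fun y hy ↦ sub_mem (hK x _ (hφ.2 y hy)).1 (hφ.2 _ (hR x y hy).1)⟩)
    (by
      rintro x φ ⟨a, ha, hφ⟩
      refine ⟨mul x a, (hR x a ha).1, fun y ↦ ?_⟩
      have h := sub_mem (hK x _ (hφ y)).1 (hφ (mul x y))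
      rw [map_sub, hleib x a y] at h
      rw [hρ_apply]
      convert h using 1
      abel)
    (fun r hr φ hφ ↦ ⟨0, zero_mem _, fun y ↦ by
      rw [hρ_apply, map_zero, LinearMap.zero_apply, sub_zero]
      exact sub_mem (hRK r hr _ (hφ.1 y)) (hφ.2 _ (hR y r hr).2)⟩)
    (ρ.flip p')
    (fun x y ↦ by simp [hρ, LieRing.of_associative_ring_bracket])
    (fun x ↦ ⟨fun y ↦ sub_mem (hR x _ (hpR y)).1 (hpR _), fun y hy ↦ by
      rw [LinearMap.flip_apply, hρ_apply, hp' y hy, hp' _ (hR x y hy).1, sub_self]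
      exact zero_mem _⟩)
    (fun r hr ↦ ⟨-r, neg_mem hr, fun y ↦ by
      rw [LinearMap.flip_apply, hρ_apply, hp' _ (hR y r hr).2]
      simpa using hRK r hr _ (hpR y)⟩)
  refine ⟨p' - v, fun y ↦ sub_mem (hpR y) (hvN.1 y), fun y hy ↦ ?_, fun x ↦ ?_⟩
  · rw [LinearMap.sub_apply, hp' y hy]
    simpa using hvN.2 y hy
  · obtain ⟨a, ha, h⟩ := hv x
    refine ⟨a, ha, fun y ↦ ?_⟩
    have h := h y
    rw [LinearMap.sub_apply, LinearMap.flip_apply, hρ_apply, hρ_apply] at h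
    convert h using 2
    simp only [LinearMap.sub_apply, map_sub]
    abel

/-- If the products of elements of `R` lie in an ideal `K` not containing `R`, then `R` has a
proper supplement which is a subalgebra. -/
theorem leibniz_exists_proper_supplement {k L : Type*} [Field k] [CharZero k]
    [AddCommGroup L] [Module k L] [FiniteDimensional k L] {mul : L →ₗ[k] L →ₗ[k] L}
    (hleib : ∀ x y z : L, mul x (mul y z) = mul (mul x y) z + mul y (mul x z))
    {R K : Submodule k L} (hR : LeibnizIsIdeal mul R)
    (hmax : ∀ I : Submodule k L, LeibnizIsIdeal mul I → (∀ a ∈ I, ∀ b ∈ I, mul a b ∈ R) → I ≤ R)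
    (hK : LeibnizIsIdeal mul K) (hRK : ∀ a ∈ R, ∀ b ∈ R, mul a b ∈ K) (hle : ¬ R ≤ K) :
    ∃ T : Submodule k L, LeibnizIsSubalgebra mul T ∧ T ⊔ R = ⊤ ∧ T ≠ ⊤ := by
  obtain ⟨q, hqR, hqK, hq⟩ := leibniz_exists_projection hleib hR hmax hK hRK
  let S : Submodule k L :=
    { carrier := {x | ∀ y, mul x (q y) - q (mul x y) ∈ K}
      zero_mem' := fun y ↦ by simp
      add_mem' := fun ha hb y ↦ by
        have h := add_mem (ha y) (hb y)
        rw [sub_add_sub_comm] at h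
        simpa using h
      smul_mem' := fun t _ ha y ↦ by simpa [smul_sub] using K.smul_mem t (ha y) }
  by_cases hS : S = ⊤
  · have hcomm : ∀ x y, mul x (q y) - q (mul x y) ∈ K := fun x ↦
      (hS ▸ Submodule.mem_top : x ∈ S)
    refine ⟨K.comap q, fun x _ y hy ↦ ?_, eq_top_iff.mpr fun y _ ↦ ?_, fun h ↦ hle fun y hy ↦ ?_⟩
    · exact (K.sub_mem_iff_right (hK x _ hy).1).mp (hcomm x y)
    · refine Submodule.mem_sup.mpr ⟨y - q y, ?_, q y, hqR y, sub_add_cancel _ _⟩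
      have h := neg_mem (hqK _ (hqR y))
      rwa [neg_sub, ← map_sub] at h
    · have hy' : q y ∈ K := (h ▸ Submodule.mem_top : y ∈ K.comap q)
      exact (K.sub_mem_iff_right hy').mp (hqK y hy)
  · refine ⟨S, fun x hx z hz y ↦ ?_, eq_top_iff.mpr fun x _ ↦ ?_, hS⟩
    · have h := sub_mem (add_mem (hK x _ (hz y)).1 (hx (mul z y)))
        (add_mem (hK z _ (hx y)).1 (hz (mul x y)))
      have e1 := hleib x z (q y)
      have e2 := congrArg q (hleib x z y)
      rw [map_add] at e2
      rw [map_sub, map_sub, e1, e2] at h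
      convert h using 1
      abel
    · obtain ⟨a, ha, h⟩ := hq x
      refine Submodule.mem_sup.mpr ⟨x + a, fun y ↦ ?_, -a, neg_mem ha, by simp⟩
      have h' := sub_mem (add_mem (h y) (hRK a ha _ (hqR y))) (hqK _ (hR y a ha).2)
      simp only [map_add, LinearMap.add_apply]
      convert h' using 1
      abel

theorem leibnizMulSpan_le {k L : Type*} [Field k] [AddCommGroup L] [Module k L]
    {mul : L →ₗ[k] L →ₗ[k] L} {I J P : Submodule k L} :
    LeibnizMulSpan mul I J ≤ P ↔ ∀ a ∈ I, ∀ b ∈ J, mul a b ∈ P := by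
  refine Submodule.span_le.trans ⟨fun h a ha b hb ↦ h ⟨a, ha, b, hb, rfl⟩, ?_⟩
  rintro h _ ⟨a, ha, b, hb, rfl⟩
  exact h a ha b hb

theorem mul_mem_leibnizMulSpan {k L : Type*} [Field k] [AddCommGroup L] [Module k L]
    (mul : L →ₗ[k] L →ₗ[k] L) {I J : Submodule k L} {a b : L} (ha : a ∈ I) (hb : b ∈ J) :
    mul a b ∈ LeibnizMulSpan mul I J :=
  leibnizMulSpan_le.mp le_rfl a ha b hb

/-- The square of an ideal is an ideal. -/
theorem LeibnizIsIdeal.leibnizMulSpan_self {k L : Type*} [Field k] [AddCommGroup L] [Module k L]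
    {mul : L →ₗ[k] L →ₗ[k] L}
    (hleib : ∀ x y z : L, mul x (mul y z) = mul (mul x y) z + mul y (mul x z))
    {I : Submodule k L} (hI : LeibnizIsIdeal mul I) :
    LeibnizIsIdeal mul (LeibnizMulSpan mul I I) := by
  intro x c hc
  have hle : LeibnizMulSpan mul I I ≤ (LeibnizMulSpan mul I I).comap (mul x) ⊓
      (LeibnizMulSpan mul I I).comap (mul.flip x) := by
    refine leibnizMulSpan_le.mpr fun a ha b hb ↦ ⟨?_, ?_⟩
    · change mul x (mul a b) ∈ LeibnizMulSpan mul I I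
      rw [hleib x a b]
      exact add_mem (mul_mem_leibnizMulSpan mul (hI x a ha).1 hb)
        (mul_mem_leibnizMulSpan mul ha (hI x b hb).1)
    · change mul (mul a b) x ∈ LeibnizMulSpan mul I I
      rw [eq_sub_of_add_eq (hleib a b x).symm]
      exact sub_mem (mul_mem_leibnizMulSpan mul ha (hI x b hb).2)
        (mul_mem_leibnizMulSpan mul hb (hI x a ha).2)
  exact hle hc

/-- A nonzero soluble subspace is not contained in its square. -/
theorem LeibnizIsSoluble.not_le_leibnizMulSpan_self {k L : Type*} [Field k] [AddCommGroup L]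
    [Module k L] {mul : L →ₗ[k] L →ₗ[k] L} {R : Submodule k L} (hR : LeibnizIsSoluble mul R)
    (hbot : R ≠ ⊥) : ¬ R ≤ LeibnizMulSpan mul R R := by
  intro hle
  obtain ⟨n, hn⟩ := hR
  have hmem : ∀ n, R ≤ LeibnizDerivedSeries mul R n := by
    intro n
    induction n with
    | zero => exact le_rfl
    | succ n ih =>
      exact hle.trans (leibnizMulSpan_le.mpr fun a ha b hb ↦
        mul_mem_leibnizMulSpan mul (ih ha) (ih hb))
  exact hbot (eq_bot_iff.mpr (hn ▸ hmem n))

/-- The derived series is compatible with homomorphisms. -/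
theorem map_leibnizDerivedSeries_le {k L M : Type*} [Field k] [AddCommGroup L] [Module k L]
    [AddCommGroup M] [Module k M] {mul : L →ₗ[k] L →ₗ[k] L} {mul' : M →ₗ[k] M →ₗ[k] M}
    (φ : M →ₗ[k] L) (hφ : ∀ x y, φ (mul' x y) = mul (φ x) (φ y)) {I : Submodule k M}
    {J : Submodule k L} {m : ℕ} (h : (LeibnizDerivedSeries mul' I m).map φ ≤ J) (n : ℕ) :
    (LeibnizDerivedSeries mul' I (m + n)).map φ ≤ LeibnizDerivedSeries mul J n := by
  induction n with
  | zero => exact h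
  | succ n ih =>
    rw [Submodule.map_le_iff_le_comap]
    refine leibnizMulSpan_le.mpr fun a ha b hb ↦ ?_
    rw [Submodule.mem_comap, hφ]
    exact mul_mem_leibnizMulSpan mul (ih (Submodule.mem_map_of_mem ha))
      (ih (Submodule.mem_map_of_mem hb))

/-- A soluble ideal `R` containing each ideal whose square lies in `R` is complemented by a
subalgebra. -/
theorem leibniz_exists_subalgebra_isCompl {k L : Type*} [Field k] [CharZero k]
    [AddCommGroup L] [Module k L] [FiniteDimensional k L] (mul : L →ₗ[k] L →ₗ[k] L)
    (hleib : ∀ x y z : L, mul x (mul y z) = mul (mul x y) z + mul y (mul x z))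
    (R : Submodule k L) (hR : LeibnizIsIdeal mul R) (hsol : LeibnizIsSoluble mul R)
    (hmax : ∀ I : Submodule k L, LeibnizIsIdeal mul I → (∀ a ∈ I, ∀ b ∈ I, mul a b ∈ R) → I ≤ R) :
    ∃ S : Submodule k L, LeibnizIsSubalgebra mul S ∧ S ⊔ R = ⊤ ∧ S ⊓ R = ⊥ := by
  induction hn : finrank k L using Nat.strong_induction_on generalizing L with
  | _ n ih =>
  subst hn
  by_cases hbot : R = ⊥
  · exact ⟨⊤, fun _ _ _ _ ↦ Submodule.mem_top, top_sup_eq _, by rw [hbot, inf_bot_eq]⟩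
  obtain ⟨T, hT, hTR, hTtop⟩ := leibniz_exists_proper_supplement hleib hR hmax
    (hR.leibnizMulSpan_self hleib) (fun a ha b hb ↦ mul_mem_leibnizMulSpan mul ha hb)
    (hsol.not_le_leibnizMulSpan_self hbot)
  let mulT : T →ₗ[k] T →ₗ[k] T := LinearMap.mk₂ k (fun x y ↦ ⟨mul x y, hT x x.2 y y.2⟩)
    (fun _ _ _ ↦ Subtype.ext (by simp)) (fun _ _ _ ↦ Subtype.ext (by simp))
    (fun _ _ _ ↦ Subtype.ext (by simp)) (fun _ _ _ ↦ Subtype.ext (by simp))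
  have hmulT : ∀ x y, T.subtype (mulT x y) = mul (T.subtype x) (T.subtype y) := fun _ _ ↦ rfl
  obtain ⟨S, hS, hSR, hSbot⟩ := ih (finrank k T) (Submodule.finrank_lt hTtop) mulT
    (fun x y z ↦ Subtype.ext (hleib x y z)) (R.comap T.subtype)
    (fun x a ha ↦ hR x a ha)
    (by
      obtain ⟨n, hn⟩ := hsol
      have h := map_leibnizDerivedSeries_le T.subtype hmulT (m := 0)
        (Submodule.map_comap_le T.subtype R) n
      rw [hn, le_bot_iff, (Submodule.map_injective_of_injective T.subtype_injective).eq_iff'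
        (Submodule.map_bot _)] at h
      exact ⟨_, h⟩)
    (fun I hI hII ↦ by
      rw [← Submodule.map_le_iff_le_comap]
      refine le_sup_left.trans (hmax (I.map T.subtype ⊔ R) ?_ ?_)
      · intro x a ha
        obtain ⟨t, ht, r, hr, rfl⟩ :=
          Submodule.mem_sup.mp (hTR ▸ Submodule.mem_top : x ∈ T ⊔ R)
        obtain ⟨_, ⟨i, hi, rfl⟩, s, hs, rfl⟩ := Submodule.mem_sup.mp ha
        have h := hI ⟨t, ht⟩ i hi
        have h₁ : mul (t + r) (i + s) = mul t i + (mul r i + mul (t + r) s) := by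
          simp only [map_add, LinearMap.add_apply]
          abel
        have h₂ : mul (i + s) (t + r) = mul i t + (mul i r + mul s (t + r)) := by
          simp only [map_add, LinearMap.add_apply]
          abel
        exact ⟨Submodule.mem_sup.mpr ⟨_, ⟨_, h.1, rfl⟩, _,
            add_mem (hR i r hr).2 (hR (t + r) s hs).1, h₁.symm⟩,
          Submodule.mem_sup.mpr ⟨_, ⟨_, h.2, rfl⟩, _,
            add_mem (hR i r hr).1 (hR (t + r) s hs).2, h₂.symm⟩⟩
      · intro a ha b hb
        obtain ⟨_, ⟨i, hi, rfl⟩, r, hr, rfl⟩ := Submodule.mem_sup.mp ha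
        obtain ⟨_, ⟨j, hj, rfl⟩, s, hs, rfl⟩ := Submodule.mem_sup.mp hb
        simp only [map_add, LinearMap.add_apply]
        exact add_mem (add_mem (hII i hi j hj) (hR _ r hr).2)
          (add_mem (hR _ s hs).1 (hR _ s hs).1)) rfl
  refine ⟨S.map T.subtype, ?_, ?_, ?_⟩
  · rintro _ ⟨x, hx, rfl⟩ _ ⟨y, hy, rfl⟩
    exact ⟨mulT x y, hS x hx y hy, rfl⟩
  · rw [eq_top_iff, ← hTR]
    refine sup_le (fun t ht ↦ ?_) le_sup_right
    obtain ⟨s, hs, r, hr, h⟩ := Submodule.mem_sup.mp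
      (hSR ▸ Submodule.mem_top : (⟨t, ht⟩ : T) ∈ S ⊔ R.comap T.subtype)
    exact Submodule.mem_sup.mpr ⟨s, ⟨s, hs, rfl⟩, r, hr, congrArg Subtype.val h⟩
  · refine (Submodule.eq_bot_iff _).mpr ?_
    rintro _ ⟨⟨s, hs, rfl⟩, hsR⟩
    have h : s ∈ S ⊓ R.comap T.subtype := ⟨hs, hsR⟩
    rw [hSbot, Submodule.mem_bot] at h
    rw [h, map_zero]

end

/-- Levi's theorem for Leibniz algebras: a finite-dimensional left Leibniz algebra over a
field of characteristic 0 splits over its soluble radical `R`. -/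
theorem leibniz_levi_splitting {k L : Type*} [Field k] [CharZero k]
    [AddCommGroup L] [Module k L] [FiniteDimensional k L]
    (mul : L →ₗ[k] L →ₗ[k] L)
    (hleib : ∀ x y z : L, mul x (mul y z) = mul (mul x y) z + mul y (mul x z))
    (R : Submodule k L)
    (hRideal : LeibnizIsIdeal mul R)
    (hRsol : LeibnizIsSoluble mul R)
    (hRmax : ∀ I : Submodule k L, LeibnizIsIdeal mul I → LeibnizIsSoluble mul I → I ≤ R) :
    ∃ S : Submodule k L, LeibnizIsSubalgebra mul S ∧ S ⊔ R = ⊤ ∧ S ⊓ R = ⊥ := by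
  refine leibniz_exists_subalgebra_isCompl mul hleib R hRideal hRsol fun I hI hII ↦ hRmax I hI ?_
  obtain ⟨n, hn⟩ := hRsol
  have h := map_leibnizDerivedSeries_le (mul := mul) LinearMap.id (fun _ _ ↦ rfl) (I := I) (m := 1)
    ((Submodule.map_id _).trans_le (leibnizMulSpan_le.mpr hII)) n
  rw [hn, le_bot_iff, Submodule.map_id] at h
  exact ⟨_, h⟩
end

section
/- Let L be a finite-dimensional left Leibniz algebra over a field k of characteristic 0 whose soluble radical equals its Leibniz kernel, K = Leib(L). Then there exists a subalgebra S of L with S + K = L and S ∩ K = 0. -/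
/-- The Leibniz kernel: the subspace spanned by the squares `x * x`. -/
def LeibnizKernel {k L : Type*} [Field k] [AddCommGroup L] [Module k L]
    (mul : L →ₗ[k] L →ₗ[k] L) : Submodule k L :=
  Submodule.span k {a | ∃ x : L, a = mul x x}

namespace LieModule

open Module

/-- The invariance of the Casimir element of a nondegenerate form under a skew-adjoint map. -/
lemma sum_dualBasis_skewAdjoint {k J M ι : Type*} [Field k] [AddCommGroup J] [Module k J]
    [AddCommGroup M] [Module k M] [Fintype ι] [DecidableEq ι] (B : LinearMap.BilinForm k J) (hB : B.Nondegenerate) (hs : B.IsSymm)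
    (b : Basis ι k J) (D : J →ₗ[k] J) (hD : ∀ y z, B (D y) z = -B y (D z))
    (β : J →ₗ[k] J →ₗ[k] M) :
    ∑ i, (β (D (b i)) (B.dualBasis hB b i) + β (b i) (D (B.dualBasis hB b i))) = 0 := by
  set b' := B.dualBasis hB b
  have h₁ (y : J) : y = ∑ j, B y (b' j) • b j := by
    conv_lhs => rw [← b.sum_repr y]
    refine Finset.sum_congr rfl fun j _ ↦ ?_
    congr 1
    conv_rhs => rw [← b.sum_repr y]
    simp only [b', map_sum, map_smul, LinearMap.sum_apply, LinearMap.smul_apply,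
      LinearMap.BilinForm.apply_dualBasis_right hB hs]
    simp
  have h₂ (y : J) : y = ∑ j, B (b j) y • b' j := by
    conv_lhs => rw [← b'.sum_repr y]
    refine Finset.sum_congr rfl fun j _ ↦ ?_
    rw [LinearMap.BilinForm.dualBasis_repr_apply, hs.eq]
  have e₁ (i : ι) : β (D (b i)) (b' i) = ∑ j, B (D (b i)) (b' j) • β (b j) (b' i) := by
    conv_lhs => rw [h₁ (D (b i))]
    simp
  have e₂ (i : ι) : β (b i) (D (b' i)) = ∑ j, B (b j) (D (b' i)) • β (b i) (b' j) := by
    conv_lhs => rw [h₂ (D (b' i))]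
    simp
  rw [Finset.sum_add_distrib]
  simp_rw [e₁, e₂]
  rw [Finset.sum_comm, ← Finset.sum_add_distrib]
  refine Finset.sum_eq_zero fun i _ ↦ ?_
  rw [← Finset.sum_add_distrib]
  exact Finset.sum_eq_zero fun j _ ↦ by simp [hD]

section Semisimple

variable {k 𝔤 M : Type*} [Field k] [CharZero k] [LieRing 𝔤] [LieAlgebra k 𝔤]
  [FiniteDimensional k 𝔤] [LieAlgebra.HasTrivialRadical k 𝔤]
  [AddCommGroup M] [Module k M] [LieRingModule 𝔤 M] [LieModule k 𝔤 M] [FiniteDimensional k M]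

variable (k 𝔤) in
/-- A finite-dimensional Lie algebra with trivial radical in characteristic zero is perfect. -/
lemma derivedSeries_one_eq_top_of_hasTrivialRadical : LieAlgebra.derivedSeries k 𝔤 1 = ⊤ := by
  set D := LieAlgebra.derivedSeries k 𝔤 1
  have hc := D.isCompl_killingCompl
  have hJ : IsLieAbelian D.killingCompl := by
    refine ⟨fun x y ↦ Subtype.ext ?_⟩
    have h₁ : ⁅(x : 𝔤), (y : 𝔤)⁆ ∈ D := by
      change _ ∈ LieAlgebra.derivedSeries k 𝔤 1
      rw [LieAlgebra.derivedSeries_def, LieAlgebra.derivedSeriesOfIdeal_succ]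
      exact LieSubmodule.lie_mem_lie (LieSubmodule.mem_top _) (LieSubmodule.mem_top _)
    have h₂ : ⁅(x : 𝔤), (y : 𝔤)⁆ ∈ D.killingCompl := D.killingCompl.lie_mem y.2
    simpa [hc.inf_eq_bot] using (LieSubmodule.mem_inf ..).mpr ⟨h₁, h₂⟩
  rw [LieAlgebra.HasTrivialRadical.eq_bot_of_isSolvable D.killingCompl] at hc
  simpa using hc.sup_eq_top

/-- A finite-dimensional representation with vanishing trace form is trivial. -/
lemma isTrivial_of_traceForm_eq_zero (h : traceForm k 𝔤 M = 0) : IsTrivial 𝔤 M := by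
  have hnil : IsNilpotent 𝔤 M := by
    have := isNilpotent_derivedSeries_of_traceForm_eq_zero h
    rw [isNilpotent_iff_forall' (R := k)] at this ⊢
    exact fun x ↦ this ⟨x, derivedSeries_one_eq_top_of_hasTrivialRadical k 𝔤 ▸ LieSubmodule.mem_top x⟩
  obtain ⟨n, hn⟩ := IsNilpotent.nilpotent k 𝔤 M
  have key (j : ℕ) (x : 𝔤) (m : M) : ⁅x, m⁆ ∈ lowerCentralSeries k 𝔤 M j := by
    induction j generalizing x m with
    | zero => simp
    | succ j ih =>
      have hx : x ∈ (⁅(⊤ : LieIdeal k 𝔤), (⊤ : LieIdeal k 𝔤)⁆ : LieIdeal k 𝔤).toSubmodule := by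
        have := derivedSeries_one_eq_top_of_hasTrivialRadical k 𝔤
        rw [LieAlgebra.derivedSeries_def, LieAlgebra.derivedSeriesOfIdeal_succ,
          LieAlgebra.derivedSeriesOfIdeal_zero] at this
        simp [this]
      rw [LieSubmodule.lieIdeal_oper_eq_linear_span'] at hx
      induction hx using Submodule.span_induction with
      | zero => simp
      | add _ _ _ _ hy hz => rw [add_lie]; exact add_mem hy hz
      | smul c _ _ hy => rw [smul_lie]; exact (lowerCentralSeries k 𝔤 M _).smul_mem c hy
      | mem _ hy =>
        obtain ⟨y, -, z, -, rfl⟩ := hy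
        rw [lie_lie, lowerCentralSeries_succ]
        exact sub_mem (LieSubmodule.lie_mem_lie (LieSubmodule.mem_top _) (ih ..))
          (LieSubmodule.lie_mem_lie (LieSubmodule.mem_top _) (ih ..))
  exact ⟨fun x m ↦ by simpa [hn] using key n x m⟩

/-- The Casimir operator of a representation with nonzero trace form: an endomorphism of nonzero
trace whose values are sums of elements `⁅x, m⁆`. -/
lemma exists_casimir (h : traceForm k 𝔤 M ≠ 0) :
    ∃ C : M →ₗ⁅k, 𝔤⁆ M, LinearMap.trace k M C ≠ 0 ∧
      ∀ W : LieSubmodule k 𝔤 M, (∀ (x : 𝔤) (m : M), ⁅x, m⁆ ∈ W) → ∀ m, C m ∈ W := by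
  classical
  let I : LieIdeal k 𝔤 :=
    { LinearMap.ker (traceForm k 𝔤 M) with
      lie_mem := fun {x y} hy ↦ by
        change traceForm k 𝔤 M ⁅x, y⁆ = 0
        replace hy : traceForm k 𝔤 M y = 0 := hy
        ext z
        rw [traceForm_apply_lie_apply', hy]
        simp }
  have hI {y : 𝔤} : y ∈ I ↔ traceForm k 𝔤 M y = 0 := Iff.rfl
  set J := I.killingCompl
  have hc : IsCompl I J := I.isCompl_killingCompl
  let B : LinearMap.BilinForm k J := (traceForm k 𝔤 M).restrict J.toSubmodule
  have hBdef (y z : J) : B y z = traceForm k 𝔤 M y z := rfl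
  have hs : B.IsSymm := ⟨fun y z ↦ traceForm_comm k 𝔤 M y z⟩
  have hB : B.Nondegenerate := by
    refine hs.isRefl.nondegenerate_iff_separatingLeft.mpr fun y hy ↦ Subtype.ext ?_
    have : (y : 𝔤) ∈ I := by
      refine hI.mpr (LinearMap.ext fun z ↦ ?_)
      obtain ⟨u, hu, w, hw, rfl⟩ := (LieSubmodule.mem_sup _ _ z).mp
        (hc.sup_eq_top ▸ LieSubmodule.mem_top z)
      have hw' : traceForm k 𝔤 M y w = 0 := hy ⟨w, hw⟩
      rw [map_add, traceForm_comm, hI.mp hu, hw']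
      simp
    simpa [hc.inf_eq_bot] using (LieSubmodule.mem_inf ..).mpr ⟨this, y.2⟩
  let b := finBasis k J
  let b' := B.dualBasis hB b
  have hJ : finrank k J ≠ 0 := by
    intro h0
    have hbot : J = ⊥ := by
      rw [← LieSubmodule.toSubmodule_eq_bot]
      exact Submodule.finrank_eq_zero.mp h0
    rw [hbot] at hc
    have htop : I = ⊤ := by simpa using hc.sup_eq_top
    exact h (LinearMap.ext fun x ↦ hI.mp (htop ▸ LieSubmodule.mem_top x))
  let C : M →ₗ[k] M := ∑ i, toEnd k 𝔤 M (b i) ∘ₗ toEnd k 𝔤 M (b' i)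
  have hC (m : M) : C m = ∑ i, ⁅(b i : 𝔤), ⁅(b' i : 𝔤), m⁆⁆ := by simp [C]
  refine ⟨{ C with map_lie' := ?_ }, ?_, fun W hW m ↦ ?_⟩
  · intro x m
    let β : J →ₗ[k] J →ₗ[k] M := LinearMap.mk₂ k (fun y z ↦ ⁅(y : 𝔤), ⁅(z : 𝔤), m⁆⁆)
      (by simp) (by simp) (by simp) (by simp)
    have key := sum_dualBasis_skewAdjoint B hB hs b (toEnd k 𝔤 J x)
      (fun y z ↦ by simpa [hBdef] using traceForm_apply_lie_apply' k 𝔤 M x y z) β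
    simp only [β, LinearMap.mk₂_apply, toEnd_apply_apply, LieSubmodule.coe_bracket] at key
    change C ⁅x, m⁆ = ⁅x, C m⁆
    rw [hC, hC, lie_sum, ← sub_eq_zero, ← neg_eq_zero, ← key, ← Finset.sum_sub_distrib,
      ← Finset.sum_neg_distrib]
    refine Finset.sum_congr rfl fun i _ ↦ ?_
    rw [leibniz_lie x (b i : 𝔤), leibniz_lie x (b' i : 𝔤), lie_add]
    abel
  · change LinearMap.trace k M C ≠ 0
    have (i : Fin (finrank k J)) : LinearMap.trace k M (toEnd k 𝔤 M (b i) ∘ₗ toEnd k 𝔤 M (b' i)) = 1 := by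
      rw [← traceForm_apply_apply, ← hBdef]
      simp [b', LinearMap.BilinForm.apply_dualBasis_right hB hs]
    simpa [C, this] using hJ
  · change C m ∈ W
    rw [hC]
    exact sum_mem fun i _ ↦ hW _ _

/-- If `𝔤` maps `M` into a submodule `W`, then any element of `M` outside of `W` can be replaced by
an invariant one. -/
lemma exists_notMem_maxTrivSubmodule (W : LieSubmodule k 𝔤 M)
    (hW : ∀ (x : 𝔤) (m : M), ⁅x, m⁆ ∈ W) (hne : ∃ v, v ∉ W) :
    ∃ v ∉ W, v ∈ maxTrivSubmodule k 𝔤 M := by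
  induction hn : finrank k M using Nat.strong_induction_on generalizing M with
  | _ n ih =>
  obtain ⟨v, hv⟩ := hne
  by_cases h : traceForm k 𝔤 M = 0
  · have := isTrivial_of_traceForm_eq_zero h
    exact ⟨v, hv, fun x ↦ trivial_lie_zero 𝔤 M x v⟩
  obtain ⟨C, hC, hCW⟩ := exists_casimir h
  obtain ⟨j, hj, hj0⟩ := ((C : End k M).eventually_isCompl_ker_pow_range_pow.and
    (Filter.eventually_ge_atTop 1)).exists
  let V : LieSubmodule k 𝔤 M :=
    { LinearMap.ker ((C : End k M) ^ j) with
      lie_mem := fun {x m} hm ↦ by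
        replace hm : ((C : End k M) ^ j) m = 0 := hm
        change ((C : End k M) ^ j) ⁅x, m⁆ = 0
        have hcomm : Commute ((C : End k M) ^ j) (toEnd k 𝔤 M x) :=
          .pow_left (LinearMap.ext fun m ↦ C.map_lie x m) j
        have := LinearMap.congr_fun hcomm.eq m
        simpa [hm] using this }
  have hlt : finrank k V < n := by
    refine hn ▸ Submodule.finrank_lt (s := V.toSubmodule) fun htop ↦ hC ?_
    have : _root_.IsNilpotent (C : End k M) := ⟨j, LinearMap.ker_eq_top.mp htop⟩
    exact (LinearMap.isNilpotent_trace_of_isNilpotent this).eq_zero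
  obtain ⟨a, ha, c, ⟨d, rfl⟩, rfl⟩ := Submodule.mem_sup.mp
    (hj.sup_eq_top ▸ Submodule.mem_top (x := v))
  have haW : a ∉ W := fun h ↦ hv <| add_mem h <| by
    obtain ⟨j, rfl⟩ := Nat.exists_eq_add_of_le' hj0
    rw [pow_succ']
    exact hCW W hW _
  obtain ⟨w, hwW, hw⟩ := ih _ hlt (W.comap V.incl) (fun x m ↦ hW x m) ⟨⟨a, ha⟩, haW⟩ rfl
  refine ⟨w, hwW, fun x ↦ congrArg Subtype.val (hw x)⟩

/-- **Weyl's theorem on complete reducibility**. -/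
theorem exists_isCompl_of_hasTrivialRadical (N : LieSubmodule k 𝔤 M) :
    ∃ N' : LieSubmodule k 𝔤 M, IsCompl N.toSubmodule N'.toSubmodule := by
  obtain hN | hN := subsingleton_or_nontrivial N
  · exact ⟨⊤, by simpa [Submodule.subsingleton_iff_eq_bot.mp hN] using isCompl_bot_top⟩
  let V : LieSubmodule k 𝔤 (M →ₗ[k] N) :=
    { carrier := {f | ∃ c : k, ∀ n : N, f n = c • n}
      add_mem' := by
        rintro f g ⟨c, hf⟩ ⟨d, hg⟩
        exact ⟨c + d, fun n ↦ by simp [hf, hg, add_smul]⟩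
      zero_mem' := ⟨0, by simp⟩
      smul_mem' := by
        rintro a f ⟨c, hf⟩
        exact ⟨a * c, fun n ↦ by simp [hf, mul_smul]⟩
      lie_mem := by
        rintro x f ⟨c, hf⟩
        refine ⟨0, fun n ↦ ?_⟩
        have := hf ⁅x, n⁆
        rw [LieSubmodule.coe_bracket] at this
        simp [hf, this] }
  let W : LieSubmodule k 𝔤 V :=
    { carrier := {f | ∀ n : N, f.1 n = 0}
      add_mem' := fun hf hg n ↦ by simp [hf n, hg n]
      zero_mem' := by simp
      smul_mem' := fun c f hf n ↦ by simp [hf n]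
      lie_mem := fun {x f} hf n ↦ by
        have := hf ⁅x, n⁆
        rw [LieSubmodule.coe_bracket] at this
        simp [hf n, this] }
  have hWV (x : 𝔤) (f : V) : ⁅x, f⁆ ∈ W := by
    obtain ⟨f, c, hf⟩ := f
    intro n
    have := hf ⁅x, n⁆
    rw [LieSubmodule.coe_bracket] at this
    simp [hf n, this]
  obtain ⟨p, hp⟩ := N.toSubmodule.subtype.exists_leftInverse_of_injective (by simp)
  replace hp (n : N) : p n = n := LinearMap.congr_fun hp n
  obtain ⟨m, hm⟩ := exists_ne (0 : N)
  obtain ⟨⟨f, c, hfc⟩, hfW, hf⟩ := exists_notMem_maxTrivSubmodule W hWV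
    ⟨⟨p, 1, by simpa using hp⟩, fun h ↦ hm <| by simpa [hp] using h m⟩
  have hc : c ≠ 0 := by
    rintro rfl
    exact hfW fun n ↦ by simpa using hfc n
  have hlie (x : 𝔤) (m : M) : f ⁅x, m⁆ = ⁅x, f m⁆ := by
    have := LinearMap.congr_fun (congrArg Subtype.val (hf x)) m
    exact (sub_eq_zero.mp this).symm
  refine ⟨{ LinearMap.ker f with lie_mem := fun {x m} hm ↦ ?_ }, ?_⟩
  · replace hm : f m = 0 := hm
    change f ⁅x, m⁆ = 0
    rw [hlie, hm, lie_zero]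
  · change IsCompl N.toSubmodule (LinearMap.ker f)
    have : LinearMap.ker (c⁻¹ • f) = LinearMap.ker f := LinearMap.ker_smul _ _ (inv_ne_zero hc)
    rw [← this]
    exact LinearMap.isCompl_of_proj fun n ↦ by simp [hfc, hc]

end Semisimple

end LieModule

section Leibniz

attribute [local instance] LieRing.ofAssociativeRing

variable {k L : Type*} [Field k] [AddCommGroup L] [Module k L] (mul : L →ₗ[k] L →ₗ[k] L)

/-- An ideal whose products act trivially from the left is soluble. -/
lemma leibnizIsSoluble_of_mul_mem_ker {I : Submodule k L}
    (h : ∀ x ∈ I, ∀ y ∈ I, mul (mul x y) = 0) : LeibnizIsSoluble mul I := by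
  have h₁ : LeibnizDerivedSeries mul I 1 ≤ LinearMap.ker mul := by
    refine Submodule.span_le.mpr ?_
    rintro _ ⟨x, hx, y, hy, rfl⟩
    exact h x hx y hy
  refine ⟨2, eq_bot_iff.mpr ?_⟩
  refine Submodule.span_le.mpr ?_
  rintro _ ⟨x, hx, y, -, rfl⟩
  simp [LinearMap.mem_ker.mp (h₁ hx)]

lemma leibniz_mul_mul_eq_lie
    (hleib : ∀ x y z : L, mul x (mul y z) = mul (mul x y) z + mul y (mul x z)) (x y : L) :
    mul (mul x y) = ⁅mul x, mul y⁆ :=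
  LinearMap.ext fun z ↦ by simp [LieRing.of_associative_ring_bracket, hleib x y z]

/-- The Lie algebra of left multiplications of a left Leibniz algebra. -/
def leibnizLeftMulLieSubalgebra
    (hleib : ∀ x y z : L, mul x (mul y z) = mul (mul x y) z + mul y (mul x z)) :
    LieSubalgebra k (Module.End k L) :=
  { LinearMap.range mul with
    lie_mem' := by
      rintro _ _ ⟨x, rfl⟩ ⟨y, rfl⟩
      exact ⟨mul x y, leibniz_mul_mul_eq_lie mul hleib x y⟩ }

lemma leibnizKernel_le_ker
    (hleib : ∀ x y z : L, mul x (mul y z) = mul (mul x y) z + mul y (mul x z)) :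
    LeibnizKernel mul ≤ LinearMap.ker mul := by
  refine Submodule.span_le.mpr ?_
  rintro _ ⟨x, rfl⟩
  simp [leibniz_mul_mul_eq_lie mul hleib]

/-- If all soluble ideals lie in the Leibniz kernel then the Lie algebra of left multiplications has
trivial radical. -/
lemma leibnizLeftMulLieSubalgebra_hasTrivialRadical
    (hleib : ∀ x y z : L, mul x (mul y z) = mul (mul x y) z + mul y (mul x z))
    (hrad : ∀ I : Submodule k L, LeibnizIsIdeal mul I → LeibnizIsSoluble mul I →
      I ≤ LeibnizKernel mul) :
    LieAlgebra.HasTrivialRadical k (leibnizLeftMulLieSubalgebra mul hleib) := by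
  rw [LieAlgebra.hasTrivialRadical_iff_no_abelian_ideals]
  intro A hA
  let toG : L →ₗ[k] leibnizLeftMulLieSubalgebra mul hleib :=
    mul.codRestrict (leibnizLeftMulLieSubalgebra mul hleib).toSubmodule fun x ↦ ⟨x, rfl⟩
  have hmul (x y : L) : toG (mul x y) = ⁅toG x, toG y⁆ :=
    Subtype.ext (leibniz_mul_mul_eq_lie mul hleib x y)
  have hI : A.toSubmodule.comap toG ≤ LeibnizKernel mul := by
    refine hrad _ (fun x a ha ↦ ⟨?_, ?_⟩) (leibnizIsSoluble_of_mul_mem_ker mul ?_)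
    · simpa [hmul] using A.lie_mem ha
    · simpa [hmul] using lie_mem_left k _ A _ (toG x) ha
    · intro x hx y hy
      have : ⁅(⟨toG x, hx⟩ : A), (⟨toG y, hy⟩ : A)⁆ = 0 := trivial_lie_zero ..
      have := congrArg (fun z : A ↦ ((z : leibnizLeftMulLieSubalgebra mul hleib) :
        Module.End k L)) this
      rw [leibniz_mul_mul_eq_lie mul hleib]
      exact this
  rw [eq_bot_iff]
  rintro ⟨_, x, rfl⟩ hx
  exact Subtype.ext (leibnizKernel_le_ker mul hleib (hI hx))

/-- A left Leibniz algebra whose Lie algebra of left multiplications has trivial radical is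
completely reducible under left multiplication. -/
lemma exists_isCompl_of_leftMul_hasTrivialRadical [CharZero k] [FiniteDimensional k L]
    (hleib : ∀ x y z : L, mul x (mul y z) = mul (mul x y) z + mul y (mul x z))
    [LieAlgebra.HasTrivialRadical k (leibnizLeftMulLieSubalgebra mul hleib)] (N : Submodule k L)
    (hN : ∀ x, ∀ a ∈ N, mul x a ∈ N) :
    ∃ S : Submodule k L, (∀ x, ∀ a ∈ S, mul x a ∈ S) ∧ IsCompl N S := by
  let N' : LieSubmodule k (leibnizLeftMulLieSubalgebra mul hleib) L :=
    { N with
      lie_mem := by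
        rintro ⟨_, x, rfl⟩ a ha
        exact hN x a ha }
  obtain ⟨S, hS⟩ := LieModule.exists_isCompl_of_hasTrivialRadical N'
  exact ⟨S.toSubmodule, fun x a ha ↦
    S.lie_mem (x := (⟨mul x, x, rfl⟩ : leibnizLeftMulLieSubalgebra mul hleib)) ha, hS⟩

end Leibniz

/-- If the soluble radical of a finite-dimensional Leibniz algebra over a field of
characteristic 0 equals its Leibniz kernel `K` (i.e. every soluble ideal is contained
in `K`), then `L` splits over `K`. -/
theorem leibniz_splits_over_kernel {k L : Type*} [Field k] [CharZero k]
    [AddCommGroup L] [Module k L] [FiniteDimensional k L]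
    (mul : L →ₗ[k] L →ₗ[k] L)
    (hleib : ∀ x y z : L, mul x (mul y z) = mul (mul x y) z + mul y (mul x z))
    (hrad : ∀ I : Submodule k L, LeibnizIsIdeal mul I → LeibnizIsSoluble mul I →
      I ≤ LeibnizKernel mul) :
    ∃ S : Submodule k L, LeibnizIsSubalgebra mul S ∧
      S ⊔ LeibnizKernel mul = ⊤ ∧ S ⊓ LeibnizKernel mul = ⊥ := by
  have := leibnizLeftMulLieSubalgebra_hasTrivialRadical mul hleib hrad
  have hideal : LeibnizIsIdeal mul (LinearMap.ker mul) := fun x a ha ↦ by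
    rw [LinearMap.mem_ker] at ha
    constructor
    · ext z
      have := hleib x a z
      simpa [ha, eq_comm] using this
    · simp [ha]
  have hker : LinearMap.ker mul = LeibnizKernel mul :=
    le_antisymm (hrad _ hideal (leibnizIsSoluble_of_mul_mem_ker mul fun x hx y _ ↦ by
      simp [LinearMap.mem_ker.mp hx])) (leibnizKernel_le_ker mul hleib)
  obtain ⟨S, hS, hc⟩ := exists_isCompl_of_leftMul_hasTrivialRadical mul hleib (LeibnizKernel mul)
    fun x a ha ↦ hker ▸ (hideal x a (hker ▸ ha)).1
  exact ⟨S, fun a _ b hb ↦ hS a b hb, hc.symm.sup_eq_top, hc.symm.inf_eq_bot⟩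
end
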